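/- arXiv:2405.14798 — 2 statements merged into one kernel-verified Lean document; each statement's English description precedes it below -/
import Mathlib

section
/- On the bar construction BSV of the non-unital symmetric algebra of a cochain complex V over a field of characteristic zero, the descending factorial (λ)_j = λ(λ−1)⋯(λ−j+1) of the operator λ is given on B_kSV by the formula (λ)_j[a₁|…|a_k] = [a₁|…|a_{k−j}] ⧢ [τa_{k−j+1}] ⧢ ⋯ ⧢ [τa_k]. -/
/-!
Framework: the bar construction `BSV` of the non-unital symmetric algebra of a
cochain complex `V` over a field `F` of characteristic zero.

`V` is presented by a homogeneous basis `{x^α}` indexed by `I`, with (cohomological)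
degrees `dg : I → ℤ`; its symmetric algebra is the algebra `MvPolynomial I F` of
polynomials (the non-unital symmetric algebra `SV` is the span of the constant-term-zero
polynomials, i.e. of the elements homogeneous of polynomial degree `k ≥ 1`).

The bar construction `BSV = ⊕_{k ≥ 1} (sSV)^{⊗ k}` is realized inside the tensor algebra
`TensorAlgebra F (MvPolynomial I F)`, the bar word `[a₁|…|a_k]` being the product
`ι a₁ ⋯ ι a_k` (`bar`).  A bar word is *admissible* (`Adm`) when each of its letters is
homogeneous (both for the cohomological weighted grading and for the polynomial grading)
and lies in the non-unital symmetric algebra; admissible words span `BSV`.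

The structure `Setup` packages the differential `d` of `SV` (induced by the differential
of `V`), together with the operators of de Wilde–Lecomte on the bar construction:
the shuffle product `sh`, the two summands `d1`, `d2` of the bar codifferential `δ`, and
the operators `xi` (ξ), `rho` (ρ), `lam` (λ) and the projection `proj` (p) onto the
exterior coalgebra `∧V ⊆ BSV`; each is constrained by its defining formula from the
paper, stated on admissible bar words (with `sg` the sign `(-1)^•` and `om` the
suspended degree `ω`).
-/

open MvPolynomial

namespace DWL

noncomputable section

/-- The sign `(-1)^z`. -/
def sg (F : Type) [Field F] (z : ℤ) : F := (-1 : F) ^ z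

/-- The suspended degree `ω` of a bar word whose letters have the listed degrees:
`ω = (|a₁| - 1) + ⋯ + (|a_j| - 1)`. -/
def om (ds : List ℤ) : ℤ := ds.sum - ds.length

variable (F : Type) [Field F] [CharZero F] (I : Type) [DecidableEq I]

/-- The ambient space of the bar construction of the symmetric algebra. -/
abbrev BSV := TensorAlgebra F (MvPolynomial I F)

/-- The bar word `[a₁|…|a_k]`. -/
def bar (l : List (MvPolynomial I F)) : BSV F I :=
  (l.map (TensorAlgebra.ι F)).prod

/-- `Adm F I dg as ds ks` : the bar word with letters `as` is admissible, the letter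
`as[i]` being homogeneous of cohomological degree `ds[i]` (for the weighted grading
determined by the degrees `dg` of the basis of `V`) and of polynomial degree
`ks[i] ≥ 1` (so that it lies in the non-unital symmetric algebra `SV`). -/
def Adm (dg : I → ℤ) (as : List (MvPolynomial I F)) (ds : List ℤ) (ks : List ℕ) : Prop :=
  as.length = ds.length ∧ as.length = ks.length ∧
    ∀ i, i < as.length →
      IsWeightedHomogeneous dg (as.getD i 0) (ds.getD i 0) ∧
      (as.getD i 0).IsHomogeneous (ks.getD i 0) ∧ 1 ≤ ks.getD i 0

/-- The reduced partial derivative `∂̄_α a = ∂_α a - ε(∂_α a)`, i.e. the partial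
derivative with its constant term removed (so that it lands in `SV`). -/
def pdbar (α : I) (a : MvPolynomial I F) : MvPolynomial I F :=
  pderiv α a - C (constantCoeff (pderiv α a))

/-- The de Wilde–Lecomte package of operators on the bar construction `BSV` of the
non-unital symmetric algebra of the cochain complex `V`. -/
structure Setup (dg : I → ℤ) where
  /-- The differential of `SV`, induced by the differential of `V`. -/
  d : MvPolynomial I F →ₗ[F] MvPolynomial I F
  d_sq : d ∘ₗ d = 0
  d_deg : ∀ a m (k : ℕ), IsWeightedHomogeneous dg a m → a.IsHomogeneous k →
      IsWeightedHomogeneous dg (d a) (m + 1) ∧ (d a).IsHomogeneous k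
  d_leibniz : ∀ a b m, IsWeightedHomogeneous dg a m →
      d (a * b) = d a * b + sg F m • (a * d b)
  /-- The (graded) shuffle product `⧢` on the bar construction. -/
  sh : BSV F I →ₗ[F] BSV F I →ₗ[F] BSV F I
  /-- The summand `δ₁` of the bar codifferential, induced by the differential `d`. -/
  d1 : BSV F I →ₗ[F] BSV F I
  /-- The summand `δ₂` of the bar codifferential, induced by the product of `SV`. -/
  d2 : BSV F I →ₗ[F] BSV F I
  /-- The operator `ξ` of de Wilde–Lecomte. -/
  xi : BSV F I →ₗ[F] BSV F I
  /-- The operator `ρ`, multiplication by `k` on each bar letter lying in `S^kV`. -/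
  rho : BSV F I →ₗ[F] BSV F I
  /-- The operator `λ`, `λ[a₁|…|a_k] = [a₁|…|a_{k-1}] ⧢ [τ a_k]`. -/
  lam : BSV F I →ₗ[F] BSV F I
  /-- The projection `p` of `BSV` onto the exterior coalgebra `∧V`. -/
  proj : BSV F I →ₗ[F] BSV F I
  sh_one_left : ∀ x, sh 1 x = x
  sh_one_right : ∀ x, sh x 1 = x
  /-- Defining recursion of the graded shuffle product on bar words. -/
  sh_rec : ∀ a as da das ka kas b bs db dbs kb kbs,
      Adm F I dg (a :: as) (da :: das) (ka :: kas) →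
      Adm F I dg (b :: bs) (db :: dbs) (kb :: kbs) →
      sh (bar F I (a :: as)) (bar F I (b :: bs)) =
        TensorAlgebra.ι F a * sh (bar F I as) (bar F I (b :: bs)) +
          sg F (om (da :: das) * (db - 1)) •
            (TensorAlgebra.ι F b * sh (bar F I (a :: as)) (bar F I bs))
  /-- `δ₁[a₁|…|a_k] = Σ_j (-1)^{ω_{j-1}} [a₁|…|d a_j|…|a_k]`. -/
  d1_bar : ∀ as ds ks, Adm F I dg as ds ks →
      d1 (bar F I as) = ∑ j ∈ Finset.range as.length,
        sg F (om (ds.take j)) • bar F I (as.set j (d (as.getD j 0)))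
  /-- `δ₂[a₁|…|a_k] = Σ_j (-1)^{ω_j + 1} [a₁|…|a_j a_{j+1}|…|a_k]`. -/
  d2_bar : ∀ as ds ks, Adm F I dg as ds ks →
      d2 (bar F I as) = ∑ j ∈ Finset.range (as.length - 1),
        sg F (om (ds.take (j + 1)) + 1) •
          bar F I (as.take j ++ [as.getD j 0 * as.getD (j + 1) 0] ++ as.drop (j + 2))
  /-- `ρ` multiplies an admissible bar word by the sum of the polynomial degrees of
  its letters. -/
  rho_bar : ∀ as ds ks, Adm F I dg as ds ks →
      rho (bar F I as) = (ks.sum : F) • bar F I as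
  /-- `ξ[a₁|…|a_k] = Σ_{0 ≤ i < j ≤ k} Σ_α (-1)^{ω_i + |x^α|(ω_{j-1} - ω_i + 1)}
  [a₁|…|a_i|x^α|…|∂_α a_j - ε(∂_α a_j)|…|a_k]`. -/
  xi_bar : ∀ as ds ks, Adm F I dg as ds ks →
      xi (bar F I as) = ∑ j ∈ Finset.range as.length, ∑ i ∈ Finset.range (j + 1),
        ∑ α ∈ (as.getD j 0).vars,
          sg F (om (ds.take i) + dg α * (om (ds.take j) - om (ds.take i) + 1)) •
            bar F I (as.take i ++ [X α] ++ (as.take j).drop i ++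
              [pdbar F I α (as.getD j 0)] ++ as.drop (j + 1))
  /-- `λ[a₁|…|a_k] = [a₁|…|a_{k-1}] ⧢ [τ a_k]`, where `τ` is the projection of `SV`
  onto its linear part `V = S¹V`. -/
  lam_bar : ∀ as ds ks, Adm F I dg as ds ks → ∀ h : as ≠ [],
      lam (bar F I as) =
        sh (bar F I as.dropLast) (bar F I [homogeneousComponent 1 (as.getLast h)])
  /-- `p[a₁|…|a_k] = (1/k!) [τ a₁] ⧢ ⋯ ⧢ [τ a_k]`. -/
  proj_bar : ∀ as ds ks, Adm F I dg as ds ks →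
      proj (bar F I as) = (Nat.factorial as.length : F)⁻¹ •
        (as.map fun a => bar F I [homogeneousComponent 1 a]).foldr (fun x y => sh x y) 1

end

end DWL

open DWL

/-- The descending factorial `(T)_j = T(T-1)⋯(T-j+1)` of an endomorphism `T`. -/
noncomputable def descFac {F : Type} [Field F] {M : Type} [AddCommGroup M] [Module F M]
    (T : Module.End F M) : ℕ → Module.End F M
  | 0 => 1
  | n + 1 => descFac T n * (T - (n : F) • (1 : Module.End F M))

namespace DWL

section BarWords

variable {F : Type} [Field F] {I : Type} {dg : I → ℤ}

theorem sg_add (a b : ℤ) : sg F (a + b) = sg F a * sg F b :=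
  zpow_add₀ (neg_ne_zero.mpr one_ne_zero) a b

theorem sg_mul_self (a : ℤ) : sg F a * sg F a = 1 := by
  rw [sg, ← mul_zpow]
  simp

theorem bar_nil : bar F I [] = 1 := by simp [bar]

theorem bar_cons (a : MvPolynomial I F) (as : List (MvPolynomial I F)) :
    bar F I (a :: as) = TensorAlgebra.ι F a * bar F I as := by simp [bar]

theorem bar_singleton (a : MvPolynomial I F) : bar F I [a] = TensorAlgebra.ι F a := by
  simp [bar]

theorem bar_append (as bs : List (MvPolynomial I F)) :
    bar F I (as ++ bs) = bar F I as * bar F I bs := by simp [bar]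

theorem om_cons (d : ℤ) (ds : List ℤ) : om (d :: ds) = (d - 1) + om ds := by
  simp only [om, List.sum_cons, List.length_cons]
  push_cast
  ring

/-- `IsLetter dg p a`: the polynomial `a` is an admissible bar letter of suspended degree `p`. -/
def IsLetter (dg : I → ℤ) (p : ℤ) (a : MvPolynomial I F) : Prop :=
  IsWeightedHomogeneous dg a (p + 1) ∧ ∃ k, 1 ≤ k ∧ a.IsHomogeneous k

theorem adm_nil : Adm F I dg [] [] [] := by simp [Adm]

theorem adm_cons_iff {a : MvPolynomial I F} {as : List (MvPolynomial I F)} {d : ℤ}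
    {ds : List ℤ} {k : ℕ} {ks : List ℕ} :
    Adm F I dg (a :: as) (d :: ds) (k :: ks) ↔
      (IsWeightedHomogeneous dg a d ∧ a.IsHomogeneous k ∧ 1 ≤ k) ∧ Adm F I dg as ds ks := by
  constructor
  · rintro ⟨h1, h2, h3⟩
    refine ⟨by simpa using h3 0 (by simp), by simpa using h1, by simpa using h2, fun i hi => ?_⟩
    simpa using h3 (i + 1) (by simpa using hi)
  · rintro ⟨h0, h1, h2, h3⟩
    refine ⟨by simpa using h1, by simpa using h2, fun i hi => ?_⟩
    cases i with
    | zero => simpa using h0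
    | succ i => simpa using h3 i (by simpa using hi)

/-- `IsWord dg m as`: the list `as` is an admissible bar word of suspended degree `m`. -/
inductive IsWord (dg : I → ℤ) : ℤ → List (MvPolynomial I F) → Prop
  | nil : IsWord dg 0 []
  | cons {p m : ℤ} {a : MvPolynomial I F} {as : List (MvPolynomial I F)} :
      IsLetter dg p a → IsWord dg m as → IsWord dg (p + m) (a :: as)

theorem IsWord.exists_adm {m : ℤ} {as : List (MvPolynomial I F)} (h : IsWord dg m as) :
    ∃ ds ks, Adm F I dg as ds ks ∧ om ds = m := by
  induction h with
  | nil => exact ⟨[], [], adm_nil, by simp [om]⟩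
  | @cons p m a as ha _ ih =>
    obtain ⟨ds, ks, h, rfl⟩ := ih
    obtain ⟨hw, k, hk, hh⟩ := ha
    exact ⟨(p + 1) :: ds, k :: ks, adm_cons_iff.2 ⟨⟨hw, hh, hk⟩, h⟩, by rw [om_cons]; ring⟩

theorem Adm.exists_isWord {as : List (MvPolynomial I F)} {ds : List ℤ} {ks : List ℕ}
    (h : Adm F I dg as ds ks) : ∃ m, IsWord dg m as := by
  induction as generalizing ds ks with
  | nil => exact ⟨0, .nil⟩
  | cons a as ih =>
    obtain _ | ⟨d, ds⟩ := ds
    · simp [Adm] at h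
    obtain _ | ⟨k, ks⟩ := ks
    · simp [Adm] at h
    obtain ⟨⟨hw, hh, hk⟩, h⟩ := adm_cons_iff.1 h
    obtain ⟨m, hm⟩ := ih h
    exact ⟨_, .cons (p := d - 1) ⟨by simpa using hw, k, hk, hh⟩ hm⟩

theorem IsWord.append {m n : ℤ} {as bs : List (MvPolynomial I F)} (ha : IsWord dg m as)
    (hb : IsWord dg n bs) : IsWord dg (m + n) (as ++ bs) := by
  induction ha with
  | nil => simpa using hb
  | cons h _ ih => simpa [add_assoc] using IsWord.cons h ih

theorem IsLetter.isWord {p : ℤ} {a : MvPolynomial I F} (h : IsLetter dg p a) :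
    IsWord dg p [a] := by
  simpa using IsWord.cons h .nil

theorem IsWord.exists_of_append {m : ℤ} {as bs : List (MvPolynomial I F)}
    (h : IsWord dg m (as ++ bs)) : ∃ p q, IsWord dg p as ∧ IsWord dg q bs := by
  induction as generalizing m with
  | nil => exact ⟨0, m, .nil, h⟩
  | cons a as ih =>
    cases h with
    | cons ha h =>
      obtain ⟨p, q, hp, hq⟩ := ih h
      exact ⟨_, q, .cons ha hp, hq⟩

theorem IsWord.exists_isLetter {m : ℤ} {as : List (MvPolynomial I F)} (h : IsWord dg m as)
    {a : MvPolynomial I F} (ha : a ∈ as) : ∃ p, IsLetter dg p a := by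
  induction h with
  | nil => simp at ha
  | cons hb _ ih =>
    rcases List.mem_cons.1 ha with rfl | ha
    · exact ⟨_, hb⟩
    · exact ih ha

theorem IsLetter.homogeneousComponent_one {p : ℤ} {a : MvPolynomial I F}
    (h : IsLetter dg p a) : IsLetter dg p (homogeneousComponent 1 a) := by
  obtain ⟨hw, k, hk, hh⟩ := h
  refine ⟨?_, 1, le_rfl, homogeneousComponent_isHomogeneous 1 a⟩
  rw [homogeneousComponent_of_mem hh]
  split_ifs
  · exact hw
  · exact isWeightedHomogeneous_zero F dg _

/-- The span of the admissible bar words of suspended degree `m` and length `n`. -/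
noncomputable def wordSpan (F : Type) [Field F] {I : Type} (dg : I → ℤ) (m : ℤ) (n : ℕ) :
    Submodule F (BSV F I) :=
  Submodule.span F {x | ∃ as, IsWord dg m as ∧ as.length = n ∧ bar F I as = x}

theorem IsWord.bar_mem {m : ℤ} {as : List (MvPolynomial I F)} (h : IsWord dg m as) :
    bar F I as ∈ wordSpan F dg m as.length :=
  Submodule.subset_span ⟨as, h, rfl, rfl⟩

theorem ι_mul_mem {p m : ℤ} {n : ℕ} {a : MvPolynomial I F} (ha : IsLetter dg p a)
    {x : BSV F I} (hx : x ∈ wordSpan F dg m n) :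
    TensorAlgebra.ι F a * x ∈ wordSpan F dg (p + m) (n + 1) := by
  induction hx using Submodule.span_induction with
  | mem x hx =>
    obtain ⟨as, has, rfl, rfl⟩ := hx
    rw [← bar_cons]
    exact (IsWord.cons ha has).bar_mem
  | zero => simp
  | add x y _ _ hx hy => rw [mul_add]; exact add_mem hx hy
  | smul c x _ hx => rw [mul_smul_comm]; exact Submodule.smul_mem _ c hx

namespace Setup

variable (S : Setup F I dg)

theorem sh_ι_mul {p q m : ℤ} {n : ℕ} {a v : MvPolynomial I F} (ha : IsLetter dg p a)
    (hv : IsLetter dg q v) {x : BSV F I} (hx : x ∈ wordSpan F dg m n) :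
    S.sh (TensorAlgebra.ι F a * x) (bar F I [v]) =
      TensorAlgebra.ι F a * S.sh x (bar F I [v]) +
        sg F ((p + m) * q) • (TensorAlgebra.ι F v * (TensorAlgebra.ι F a * x)) := by
  induction hx using Submodule.span_induction with
  | mem x hx =>
    obtain ⟨as, has, rfl, rfl⟩ := hx
    obtain ⟨ds, ks, h, rfl⟩ := has.exists_adm
    obtain ⟨hw, k, hk, hh⟩ := ha
    obtain ⟨hw', k', hk', hh'⟩ := hv
    have := S.sh_rec a as (p + 1) ds k ks v [] (q + 1) [] k' []
      (adm_cons_iff.2 ⟨⟨hw, hh, hk⟩, h⟩) (adm_cons_iff.2 ⟨⟨hw', hh', hk'⟩, adm_nil⟩)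
    simpa [bar_nil, S.sh_one_right, om_cons, bar_cons] using this
  | zero => simp
  | add x y _ _ hx hy =>
    simp only [mul_add, map_add, LinearMap.add_apply, smul_add, hx, hy]
    abel
  | smul c x _ hx =>
    simp only [mul_smul_comm, map_smul, LinearMap.smul_apply, hx, smul_add]
    rw [smul_comm c]

theorem sh_mem {q m : ℤ} {n : ℕ} {v : MvPolynomial I F} (hv : IsLetter dg q v)
    {x : BSV F I} (hx : x ∈ wordSpan F dg m n) :
    S.sh x (bar F I [v]) ∈ wordSpan F dg (m + q) (n + 1) := by
  induction hx using Submodule.span_induction with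
  | mem x hx =>
    obtain ⟨as, has, rfl, rfl⟩ := hx
    induction has with
    | nil =>
      rw [bar_nil, S.sh_one_left, zero_add]
      exact hv.isWord.bar_mem
    | @cons p m a as ha has ih =>
      rw [bar_cons, S.sh_ι_mul ha hv has.bar_mem]
      refine add_mem ?_ (Submodule.smul_mem _ _ ?_)
      · simpa [add_assoc] using ι_mul_mem ha ih
      · simpa [add_comm q] using ι_mul_mem hv (ι_mul_mem ha has.bar_mem)
  | zero => simp
  | add x y _ _ hx hy => rw [map_add]; exact add_mem hx hy
  | smul c x _ hx => rw [map_smul]; exact Submodule.smul_mem _ c hx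

theorem sh_bar_mul_ι {p q m : ℤ} {a v : MvPolynomial I F} (ha : IsLetter dg p a)
    (hv : IsLetter dg q v) {as : List (MvPolynomial I F)} (has : IsWord dg m as) :
    S.sh (bar F I as * TensorAlgebra.ι F a) (bar F I [v]) =
      sg F (p * q) • (S.sh (bar F I as) (bar F I [v]) * TensorAlgebra.ι F a) +
        bar F I as * TensorAlgebra.ι F a * TensorAlgebra.ι F v := by
  induction has with
  | nil =>
    have := S.sh_ι_mul ha hv IsWord.nil.bar_mem
    simp only [bar_nil, mul_one, add_zero, S.sh_one_left, bar_singleton, one_mul] at this ⊢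
    rw [this, add_comm]
  | @cons r m b as hb has ih =>
    have hmem : bar F I as * TensorAlgebra.ι F a ∈ wordSpan F dg (m + p) (as.length + 1) := by
      simpa [bar_append, bar_singleton] using (has.append ha.isWord).bar_mem
    rw [bar_cons, mul_assoc, S.sh_ι_mul hb hv hmem, ih, S.sh_ι_mul hb hv has.bar_mem,
      show (r + (m + p)) * q = p * q + (r + m) * q by ring, sg_add]
    simp only [mul_add, add_mul, smul_add, mul_smul_comm, smul_mul_assoc, mul_assoc, mul_smul]
    abel

/-- Shuffling with two letters is graded commutative. -/
theorem sh_sh_comm {p q m : ℤ} {u v : MvPolynomial I F} (hu : IsLetter dg p u)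
    (hv : IsLetter dg q v) {as : List (MvPolynomial I F)} (has : IsWord dg m as) :
    S.sh (S.sh (bar F I as) (bar F I [u])) (bar F I [v]) =
      sg F (p * q) • S.sh (S.sh (bar F I as) (bar F I [v])) (bar F I [u]) := by
  induction has with
  | nil =>
    have huv := S.sh_ι_mul hu hv IsWord.nil.bar_mem
    have hvu := S.sh_ι_mul hv hu IsWord.nil.bar_mem
    simp only [bar_nil, mul_one, add_zero, S.sh_one_left, bar_singleton] at huv hvu ⊢
    rw [huv, hvu, mul_comm q p, smul_add, smul_smul, sg_mul_self, one_smul, add_comm]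
  | @cons r m a as ha has ih =>
    have hx := has.bar_mem
    have hax := ι_mul_mem ha hx
    rw [bar_cons, S.sh_ι_mul ha hu hx, S.sh_ι_mul ha hv hx]
    simp only [map_add, map_smul, LinearMap.add_apply, LinearMap.smul_apply]
    rw [S.sh_ι_mul ha hv (S.sh_mem hu hx), S.sh_ι_mul ha hu (S.sh_mem hv hx),
      S.sh_ι_mul hu hv hax, S.sh_ι_mul hv hu hax, S.sh_ι_mul ha hu hx, S.sh_ι_mul ha hv hx, ih]
    have hs : sg F (q * p) = sg F (p * q) := by rw [mul_comm]
    have hpq : sg F (p * q) * sg F (p * q) = 1 := sg_mul_self _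
    simp only [mul_add, add_mul, sg_add, hs, smul_add, mul_smul_comm, smul_smul]
    match_scalars <;> grind

theorem lam_mul_ι {p m : ℤ} {n : ℕ} {a : MvPolynomial I F} (ha : IsLetter dg p a)
    {x : BSV F I} (hx : x ∈ wordSpan F dg m n) :
    S.lam (x * TensorAlgebra.ι F a) = S.sh x (bar F I [homogeneousComponent 1 a]) := by
  induction hx using Submodule.span_induction with
  | mem x hx =>
    obtain ⟨as, has, rfl, rfl⟩ := hx
    obtain ⟨ds, ks, h, -⟩ := (has.append ha.isWord).exists_adm
    simpa [bar_append, bar_singleton] using S.lam_bar _ _ _ h (by simp)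
  | zero => simp
  | add x y _ _ hx hy => simp only [add_mul, map_add, LinearMap.add_apply, hx, hy]
  | smul c x _ hx => simp only [smul_mul_assoc, map_smul, LinearMap.smul_apply, hx]

/-- The commutation relation between `λ` and the right shuffle with a linear letter. -/
theorem lam_sh {q m : ℤ} {n : ℕ} {v : MvPolynomial I F} (hv : IsLetter dg q v)
    (hv1 : homogeneousComponent 1 v = v) {x : BSV F I} (hx : x ∈ wordSpan F dg m (n + 1)) :
    S.lam (S.sh x (bar F I [v])) = S.sh (S.lam x) (bar F I [v]) + S.sh x (bar F I [v]) := by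
  induction hx using Submodule.span_induction with
  | mem x hx =>
    obtain ⟨as, has, hlen, rfl⟩ := hx
    obtain rfl | ⟨as, a, rfl⟩ := List.eq_nil_or_concat' as
    · simp at hlen
    obtain ⟨_, _, hw, hl⟩ := has.exists_of_append
    obtain ⟨p, ha⟩ := hl.exists_isLetter (List.mem_singleton_self a)
    have hlast := S.lam_mul_ι hv has.bar_mem
    rw [bar_append, bar_singleton, hv1] at hlast
    rw [bar_append, bar_singleton, S.lam_mul_ι ha hw.bar_mem,
      S.sh_sh_comm ha.homogeneousComponent_one hv hw]
    conv_lhs => rw [S.sh_bar_mul_ι ha hv hw, map_add, map_smul,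
      S.lam_mul_ι ha (S.sh_mem hv hw.bar_mem), hlast]
  | zero => simp
  | add x y _ _ hx hy =>
    simp only [map_add, LinearMap.add_apply, hx, hy]
    abel
  | smul c x _ hx => simp only [map_smul, LinearMap.smul_apply, hx, smul_add]

/-- The iterated right shuffle with the linear parts of a list of letters. -/
noncomputable def shTau (l : List (MvPolynomial I F)) (x : BSV F I) : BSV F I :=
  (l.map fun a => bar F I [homogeneousComponent 1 a]).foldl (fun x y => S.sh x y) x

theorem shTau_cons (a : MvPolynomial I F) (l : List (MvPolynomial I F)) (x : BSV F I) :
    S.shTau (a :: l) x = S.shTau l (S.sh x (bar F I [homogeneousComponent 1 a])) := rfl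

theorem shTau_add (l : List (MvPolynomial I F)) (x y : BSV F I) :
    S.shTau l (x + y) = S.shTau l x + S.shTau l y := by
  induction l generalizing x y with
  | nil => rfl
  | cons a l ih => simp only [shTau_cons, map_add, LinearMap.add_apply, ih]

theorem lam_shTau {p m : ℤ} {n : ℕ} {l : List (MvPolynomial I F)} (hl : IsWord dg p l)
    {x : BSV F I} (hx : x ∈ wordSpan F dg m (n + 1)) :
    S.lam (S.shTau l x) = S.shTau l (S.lam x) + (l.length : F) • S.shTau l x := by
  induction hl generalizing m n x with
  | nil => simp [shTau]
  | @cons q p a l ha _ ih =>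
    have hτ := ha.homogeneousComponent_one
    have h1 : homogeneousComponent 1 (homogeneousComponent 1 a) = homogeneousComponent 1 a := by
      rw [homogeneousComponent_of_mem (homogeneousComponent_isHomogeneous 1 a), if_pos rfl]
    rw [shTau_cons, ih (S.sh_mem hτ hx), S.lam_sh hτ h1 hx, shTau_add, shTau_cons,
      List.length_cons, Nat.cast_succ, add_smul, one_smul]
    abel

end Setup

end BarWords

end DWL

theorem commute_descFac {F : Type} [Field F] {M : Type} [AddCommGroup M] [Module F M]
    (T : Module.End F M) (n : ℕ) : Commute T (descFac T n) := by
  induction n with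
  | zero => exact Commute.one_right T
  | succ n ih =>
    exact ih.mul_right ((Commute.refl T).sub_right ((Commute.one_right T).smul_right _))

theorem descFac_succ_apply {F : Type} [Field F] {M : Type} [AddCommGroup M] [Module F M]
    (T : Module.End F M) (n : ℕ) (x : M) :
    descFac T (n + 1) x = T (descFac T n x) - (n : F) • descFac T n x := by
  have h : Commute (T - (n : F) • (1 : Module.End F M)) (descFac T n) :=
    (commute_descFac T n).sub_left ((Commute.one_left _).smul_left _)
  rw [descFac, ← h.eq]
  simp

theorem DWL.Setup.descFac_lam_bar_append {F I : Type} [Field F]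
    {dg : I → ℤ} (S : DWL.Setup F I dg) {m : ℤ} {as bs : List (MvPolynomial I F)}
    (h : IsWord dg m (as ++ bs)) :
    descFac S.lam bs.length (bar F I (as ++ bs)) = S.shTau bs (bar F I as) := by
  induction bs generalizing as with
  | nil => simp [descFac, Setup.shTau]
  | cons b bs ih =>
    rw [List.append_cons] at h ⊢
    obtain ⟨p, q, hp, hq⟩ := h.exists_of_append
    obtain ⟨r, s, hr, hs⟩ := hp.exists_of_append
    obtain ⟨t, hb⟩ := hs.exists_isLetter (List.mem_singleton_self b)
    have hmem : bar F I (as ++ [b]) ∈ wordSpan F dg p (as.length + 1) := by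
      simpa using hp.bar_mem
    rw [List.length_cons, descFac_succ_apply, ih h, S.lam_shTau hq hmem, add_sub_cancel_right,
      bar_append, bar_singleton, S.lam_mul_ι hb hr.bar_mem, S.shTau_cons]

/-- On the bar construction `BSV` of the non-unital symmetric algebra
of a cochain complex `V` over a field of characteristic zero, the descending factorial
`(λ)_j = λ(λ-1)⋯(λ-j+1)` of the operator `λ` is given on `B_kSV` by the formula
`(λ)_j [a₁|…|a_k] = [a₁|…|a_{k-j}] ⧢ [τ a_{k-j+1}] ⧢ ⋯ ⧢ [τ a_k]`. -/
theorem descFactorial_lam_formula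
    {F I : Type} [Field F] [CharZero F] [DecidableEq I]
    (dg : I → ℤ) (S : DWL.Setup F I dg) :
    ∀ as ds ks, Adm F I dg as ds ks → ∀ j, j ≤ as.length →
      descFac S.lam j (bar F I as) =
        ((as.drop (as.length - j)).map fun a =>
            bar F I [MvPolynomial.homogeneousComponent 1 a]).foldl
          (fun x y => S.sh x y) (bar F I (as.take (as.length - j))) := by
  intro as ds ks h j hj
  obtain ⟨m, hm⟩ := h.exists_isWord
  rw [← List.take_append_drop (as.length - j) as] at hm
  have := S.descFac_lam_bar_append hm
  rwa [List.take_append_drop, List.length_drop, Nat.sub_sub_self hj] at this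
end

section
/- Let (A, Z, f, g, h) be a contraction of complexes and let μ ∈ G(A) be a Hochschild cochain, with δ(μ) the associated coderivation of the bar construction BA and 𝕙 the tensor-trick homotopy on BA. If 1 + δ(μ_{(1)})h : A → A is invertible, then 1 + δ(μ)𝕙 : BA → BA is invertible. -/
/-!
Framework: contractions of complexes and the tensor trick on bar constructions,
over a field `F` of characteristic zero.

A complex is a graded module, presented by a module with a homogeneity predicate
(`HA : A → ℤ → Prop`, with the homogeneous elements spanning) and a differential of
degree `+1` squaring to zero.  A contraction `(A, Z, f, g, h)` is packaged by
`Contraction`.  The bar construction `BA = ⊕_{k≥1} (sA)^{⊗k}` is realized inside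
`TensorAlgebra F A`, with bar words `bar l = [a₁|…|a_k]`; `AdmW l ds` says the word has
homogeneous letters of the listed degrees.  The structure `BarData` packages: the bar
codifferential `dB1` induced by the differential of `A`, the (deconcatenation) coproduct
`cop`, a Hochschild cochain `mu ∈ G(A) = C*(A,A)` (a linear map `B₊A → A`, with
components `μ_{(k)}` its restrictions to the tensor powers) of degree `degmu`, the
coderivation `mucod = δ(μ)` of `BA` determined by `μ`, and the tensor-trick homotopy
`hB = 𝕙` induced by the contraction; each operator is pinned down by its defining
formula on bar words.
-/

namespace TTrick

open TensorProduct

noncomputable section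

def sg (F : Type) [Field F] (z : ℤ) : F := (-1 : F) ^ z

def om (ds : List ℤ) : ℤ := ds.sum - ds.length

variable (F : Type) [Field F] [CharZero F]
variable (A : Type) [AddCommGroup A] [Module F A]
variable (Z : Type) [AddCommGroup Z] [Module F Z]

/-- The bar word `[a₁|…|a_k]` inside the tensor algebra. -/
def bar (l : List A) : TensorAlgebra F A := (l.map (TensorAlgebra.ι F)).prod

/-- Admissible bar words: all letters homogeneous of the listed degrees. -/
def AdmW (HA : A → ℤ → Prop) (l : List A) (ds : List ℤ) : Prop :=
  l.length = ds.length ∧ ∀ i, i < l.length → HA (l.getD i 0) (ds.getD i 0)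

/-- A contraction `(A, Z, f, g, h)` of complexes: `fg = 1`, `gf = 1 - (dh + hd)`,
together with the side conditions `fh = 0`, `hg = 0`, `h² = 0`. -/
structure Contraction (HA : A → ℤ → Prop) (HZ : Z → ℤ → Prop)
    (dA : A →ₗ[F] A) (dZ : Z →ₗ[F] Z) where
  f : A →ₗ[F] Z
  g : Z →ₗ[F] A
  h : A →ₗ[F] A
  fg : f ∘ₗ g = LinearMap.id
  gf : g ∘ₗ f = LinearMap.id - (dA ∘ₗ h + h ∘ₗ dA)
  fh : f ∘ₗ h = 0
  hg : h ∘ₗ g = 0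
  hh : h ∘ₗ h = 0
  fchain : f ∘ₗ dA = dZ ∘ₗ f
  gchain : g ∘ₗ dZ = dA ∘ₗ g
  fdeg : ∀ a m, HA a m → HZ (f a) m
  gdeg : ∀ z m, HZ z m → HA (g z) m
  hdeg : ∀ a m, HA a m → HA (h a) (m - 1)

variable {F A Z}

/-- The structure of a complex: homogeneous elements span, and the differential has
degree `+1` and squares to zero. -/
structure IsCx (HA : A → ℤ → Prop) (dA : A →ₗ[F] A) : Prop where
  span_hom : Submodule.span F {a | ∃ m, HA a m} = ⊤
  d_sq : dA ∘ₗ dA = 0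
  d_deg : ∀ a m, HA a m → HA (dA a) (m + 1)

variable (F A Z)

/-- The bar-construction data over a contraction: the bar codifferential, the
deconcatenation coproduct, a Hochschild cochain `μ` with its coderivation `δ(μ)`, and
the tensor-trick homotopy `𝕙`. -/
structure BarData (HA : A → ℤ → Prop) (HZ : Z → ℤ → Prop)
    (dA : A →ₗ[F] A) (dZ : Z →ₗ[F] Z)
    (C : Contraction F A Z HA HZ dA dZ) where
  /-- The bar codifferential `δ` of `BA` induced by the differential of `A`. -/
  dB1 : TensorAlgebra F A →ₗ[F] TensorAlgebra F A
  /-- The (reduced, deconcatenation) coproduct of `BA`. -/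
  cop : TensorAlgebra F A →ₗ[F] TensorAlgebra F A ⊗[F] TensorAlgebra F A
  /-- A Hochschild cochain `μ ∈ G(A) = C*(A,A)`, i.e. a map `B₊A → A`. -/
  mu : TensorAlgebra F A →ₗ[F] A
  /-- The degree of the cochain `μ`. -/
  degmu : ℤ
  /-- The coderivation `δ(μ)` of `BA` determined by `μ`. -/
  mucod : TensorAlgebra F A →ₗ[F] TensorAlgebra F A
  /-- The tensor-trick homotopy `𝕙` on `BA`. -/
  hB : TensorAlgebra F A →ₗ[F] TensorAlgebra F A
  dB1_bar : ∀ l ds, AdmW A HA l ds →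
      dB1 (bar F A l) = ∑ j ∈ Finset.range l.length,
        sg F (om (ds.take j)) • bar F A (l.set j (dA (l.getD j 0)))
  cop_bar : ∀ l : List A,
      cop (bar F A l) = ∑ j ∈ Finset.Ioo 0 l.length,
        bar F A (l.take j) ⊗ₜ[F] bar F A (l.drop j)
  mu_deg : ∀ l ds, AdmW A HA l ds → HA (mu (bar F A l)) (om ds + degmu)
  /-- `δ(μ)[a₁|…|a_k] = Σ_{0≤i<j≤k} (-1)^{(|μ|-1)ω_i} [a₁|…|μ[a_{i+1}|…|a_j]|…|a_k]`. -/
  mucod_bar : ∀ l ds, AdmW A HA l ds →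
      mucod (bar F A l) = ∑ j ∈ Finset.Icc 1 l.length, ∑ i ∈ Finset.range j,
        sg F ((degmu - 1) * om (ds.take i)) •
          bar F A (l.take i ++ [mu (bar F A ((l.take j).drop i))] ++ l.drop j)
  /-- `𝕙[a₁|…|a_k] = Σ_j (-1)^{ω_{j-1}} [pa₁|…|pa_{j-1}|ha_j|a_{j+1}|…|a_k]`,
  where `p = gf`. -/
  hB_bar : ∀ l ds, AdmW A HA l ds →
      hB (bar F A l) = ∑ j ∈ Finset.range l.length,
        sg F (om (ds.take j)) •
          bar F A ((l.take j).map (C.g ∘ₗ C.f) ++ [C.h (l.getD j 0)] ++ l.drop (j + 1))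

end

end TTrick

open TTrick


namespace TTrick

section Signs

variable (F : Type) [Field F]

lemma sg_add (x y : ℤ) : sg F (x + y) = sg F x * sg F y :=
  zpow_add₀ (by simp) x y

lemma sg_mul_self (x : ℤ) : sg F x * sg F x = 1 := by
  rw [← sg_add, ← two_mul]
  simp [sg, zpow_mul]

lemma sg_even {x : ℤ} (hx : Even x) : sg F x = 1 := hx.neg_one_zpow

lemma sg_odd {x : ℤ} (hx : Odd x) : sg F x = -1 := hx.neg_one_zpow

lemma sg_pow_natAbs (x y : ℤ) : sg F x ^ y.natAbs = sg F (y * x) := by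
  rcases Int.even_or_odd x with hx | hx
  · rw [sg_even F hx, sg_even F (hx.mul_left y), one_pow]
  · rw [sg_odd F hx]
    rcases Int.even_or_odd y with hy | hy
    · rw [sg_even F (hy.mul_right x), (Int.natAbs_even.2 hy).neg_one_pow]
    · rw [sg_odd F (hy.mul hx), (Int.natAbs_odd.2 hy).neg_one_pow]

end Signs

lemma om_cons (m : ℤ) (ds : List ℤ) : om (m :: ds) = (m - 1) + om ds := by
  simp [om]; ring

lemma bar_nil (F : Type) [Field F] (A : Type) [AddCommGroup A] [Module F A] :
    bar F A [] = 1 := by simp [bar]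

lemma bar_cons (F : Type) [Field F] {A : Type} [AddCommGroup A] [Module F A]
    (a : A) (l : List A) : bar F A (a :: l) = TensorAlgebra.ι F a * bar F A l := by
  simp [bar]

lemma admW_nil {A : Type} [AddCommGroup A] (HA : A → ℤ → Prop) : AdmW A HA [] [] := by
  simp [AdmW]

lemma AdmW.cons {A : Type} [AddCommGroup A] {HA : A → ℤ → Prop} {a : A} {m : ℤ}
    {l : List A} {ds : List ℤ} (ha : HA a m) (hl : AdmW A HA l ds) :
    AdmW A HA (a :: l) (m :: ds) := by
  refine ⟨by simp [hl.1], fun i hi => ?_⟩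
  cases i with
  | zero => simpa using ha
  | succ i => simpa using hl.2 i (by simpa using hi)

section Operators

variable {F A : Type} [Field F] [AddCommGroup A] [Module F A]

/-- The algebra map underlying `twistedDer`: letters act by upper triangular matrices. -/
noncomputable def twistedDerAux (φ κ : A →ₗ[F] A) :
    TensorAlgebra F A →ₐ[F] Module.End F (TensorAlgebra F A × TensorAlgebra F A) :=
  TensorAlgebra.lift F
    { toFun := fun a =>
        ((LinearMap.mulLeft F (TensorAlgebra.ι F (φ a))).coprod
          (LinearMap.mulLeft F (TensorAlgebra.ι F (κ a)))).prod
          (LinearMap.mulLeft F (TensorAlgebra.ι F a) ∘ₗ LinearMap.snd F _ _)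
      map_add' := fun a b => by
        ext <;> simp [add_mul]
      map_smul' := fun c a => by
        ext <;> simp }

/-- The operator `∑ φ ⊗ ⋯ ⊗ φ ⊗ κ ⊗ 1 ⊗ ⋯ ⊗ 1` on the tensor algebra. -/
noncomputable def twistedDer (φ κ : A →ₗ[F] A) : Module.End F (TensorAlgebra F A) :=
  LinearMap.fst F _ _ ∘ₗ LinearMap.applyₗ (0, 1) ∘ₗ (twistedDerAux φ κ).toLinearMap

lemma twistedDer_one (φ κ : A →ₗ[F] A) : twistedDer φ κ 1 = 0 := by
  simp [twistedDer]

lemma twistedDerAux_ι (φ κ : A →ₗ[F] A) (a : A) (x : TensorAlgebra F A × TensorAlgebra F A) :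
    twistedDerAux φ κ (TensorAlgebra.ι F a) x =
      (TensorAlgebra.ι F (φ a) * x.1 + TensorAlgebra.ι F (κ a) * x.2,
        TensorAlgebra.ι F a * x.2) := by
  simp [twistedDerAux]

lemma twistedDerAux_snd (φ κ : A →ₗ[F] A) (x : TensorAlgebra F A) :
    ∀ y, (twistedDerAux φ κ x y).2 = x * y.2 := by
  induction x using TensorAlgebra.induction with
  | algebraMap r => intro y; simp [Algebra.smul_def]
  | ι a => intro y; simp [twistedDerAux_ι]
  | mul a b ha hb => intro y; simp [ha, hb, mul_assoc]
  | add a b ha hb => intro y; simp [ha, hb, add_mul]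

lemma twistedDer_ι_mul (φ κ : A →ₗ[F] A) (a : A) (x : TensorAlgebra F A) :
    twistedDer φ κ (TensorAlgebra.ι F a * x) =
      TensorAlgebra.ι F (κ a) * x + TensorAlgebra.ι F (φ a) * twistedDer φ κ x := by
  simp [twistedDer, twistedDerAux_ι, twistedDerAux_snd, add_comm]

/-- The algebra map underlying `contractSecond`. -/
noncomputable def contractSecondAux (ψ : A →ₗ[F] F) :
    TensorAlgebra F A →ₐ[F] Module.End F (F × F × A) :=
  TensorAlgebra.lift F
    { toFun := fun a =>
        (0 : F × F × A →ₗ[F] F).prod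
          ((ψ a • LinearMap.fst F F (F × A)).prod
            ((LinearMap.fst F F A ∘ₗ LinearMap.snd F F (F × A)).smulRight a))
      map_add' := fun a b => by
        ext <;> simp
      map_smul' := fun c a => by
        ext <;> simp }

/-- The map contracting the second letter of a two-letter word against `ψ`. -/
noncomputable def contractSecond (ψ : A →ₗ[F] F) : TensorAlgebra F A →ₗ[F] A :=
  LinearMap.snd F F A ∘ₗ LinearMap.snd F F (F × A) ∘ₗ LinearMap.applyₗ (1, 0, 0) ∘ₗ
    (contractSecondAux ψ).toLinearMap

lemma contractSecond_ι_mul_ι (ψ : A →ₗ[F] F) (a b : A) :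
    contractSecond ψ (TensorAlgebra.ι F a * TensorAlgebra.ι F b) = ψ b • a := by
  simp [contractSecond, contractSecondAux]

lemma bijective_one_add_of_locally_nilpotent {V : Type} [AddCommGroup V] [Module F V]
    (X : Module.End F V) (hX : ∀ x, ∃ n : ℕ, (X ^ n) x = 0) :
    Function.Bijective ⇑(1 + X) := by
  have key : ∀ n : ℕ, (1 + X) * ∑ i ∈ Finset.range n, (-X) ^ i = 1 - (-X) ^ n := by
    intro n
    have := mul_neg_geom_sum (-X) n
    simpa using this
  have hX' : ∀ x, ∃ n : ℕ, ((-X) ^ n) x = 0 := by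
    intro x
    obtain ⟨n, hn⟩ := hX x
    refine ⟨n, ?_⟩
    rw [neg_pow, Module.End.mul_apply, hn, map_zero]
  constructor
  · rw [injective_iff_map_eq_zero]
    intro x hx
    obtain ⟨n, hn⟩ := hX' x
    have h1 : (-X) x = x := by
      have : x + X x = 0 := by simpa using hx
      rw [LinearMap.neg_apply]
      exact (eq_neg_of_add_eq_zero_left this).symm
    have h2 : ∀ k : ℕ, ((-X) ^ k) x = x := by
      intro k
      induction k with
      | zero => simp
      | succ k ih => rw [pow_succ, Module.End.mul_apply, h1, ih]
    rw [← h2 n, hn]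
  · intro x
    obtain ⟨n, hn⟩ := hX' x
    refine ⟨(∑ i ∈ Finset.range n, (-X) ^ i) x, ?_⟩
    rw [← Module.End.mul_apply, key]
    simp [hn]

end Operators

section Filtration

variable {F A : Type} [Field F] [AddCommGroup A] [Module F A]

/-- Homogeneous letters with a weight: `3` on the image of `h`, `4` on the image of `p`,
`5` in general. -/
inductive Letter (HA : A → ℤ → Prop) (h p : A →ₗ[F] A) : A → ℤ → Prop
  | of_h {b : A} {m : ℤ} : HA b m → Letter HA h p (h b) 3
  | of_p {b : A} {m : ℤ} : HA b m → Letter HA h p (p b) 4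
  | of {b : A} {m : ℤ} : HA b m → Letter HA h p b 5

/-- Words of weighted letters, with their total weight. -/
inductive Word (HA : A → ℤ → Prop) (h p : A →ₗ[F] A) : List A → ℤ → Prop
  | nil : Word HA h p [] 0
  | cons {a : A} {w : ℤ} {l : List A} {n : ℤ} :
      Letter HA h p a w → Word HA h p l n → Word HA h p (a :: l) (n + w)

variable {HA : A → ℤ → Prop} {h p : A →ₗ[F] A}

lemma Letter.three_le {a : A} {w : ℤ} (ha : Letter HA h p a w) : 3 ≤ w := by
  cases ha <;> norm_num

lemma Word.nonneg {l : List A} {n : ℤ} (hl : Word HA h p l n) : 0 ≤ n := by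
  induction hl with
  | nil => exact le_rfl
  | cons ha _ ih => linarith [ha.three_le]

lemma Word.drop {l : List A} {n : ℤ} (hl : Word HA h p l n) (j : ℕ) :
    ∃ k ≤ n, Word HA h p (l.drop j) k := by
  induction hl generalizing j with
  | nil => exact ⟨0, le_rfl, by simpa using Word.nil⟩
  | @cons a w l n ha hl ih =>
    cases j with
    | zero => exact ⟨n + w, le_rfl, by simpa using Word.cons ha hl⟩
    | succ j =>
      obtain ⟨k, hk, hw⟩ := ih j
      exact ⟨k, by linarith [ha.three_le], by simpa using hw⟩

lemma Word.drop_succ {l : List A} {n : ℤ} (hl : Word HA h p l n) {j : ℕ} (hj : j < l.length) :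
    ∃ k ≤ n - 3, Word HA h p (l.drop (j + 1)) k := by
  cases hl with
  | nil => simp at hj
  | @cons a w l n ha hl =>
    obtain ⟨k, hk, hw⟩ := hl.drop j
    exact ⟨k, by linarith [ha.three_le], by simpa using hw⟩

variable (HA h p) in
/-- The weight filtration of the tensor algebra. -/
def wtFil (n : ℤ) : Submodule F (TensorAlgebra F A) :=
  Submodule.span F {x | ∃ l k, Word HA h p l k ∧ k ≤ n ∧ x = bar F A l}

lemma wtFil_mono {m n : ℤ} (hmn : m ≤ n) : wtFil HA h p m ≤ wtFil HA h p n := by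
  refine Submodule.span_mono ?_
  rintro x ⟨l, k, hl, hk, rfl⟩
  exact ⟨l, k, hl, hk.trans hmn, rfl⟩

lemma Word.bar_mem {l : List A} {k n : ℤ} (hl : Word HA h p l k) (hk : k ≤ n) :
    bar F A l ∈ wtFil HA h p n :=
  Submodule.subset_span ⟨l, k, hl, hk, rfl⟩

lemma wtFil_induction {V : Type} [AddCommGroup V] [Module F V] {n : ℤ}
    (φ : TensorAlgebra F A →ₗ[F] V) (S : Submodule F V)
    (H : ∀ l k, Word HA h p l k → k ≤ n → φ (bar F A l) ∈ S) :
    ∀ y ∈ wtFil HA h p n, φ y ∈ S := by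
  have : wtFil HA h p n ≤ S.comap φ := by
    refine Submodule.span_le.2 ?_
    rintro x ⟨l, k, hl, hk, rfl⟩
    exact H l k hl hk
  exact fun y hy => this hy

lemma wtFil_neg {n : ℤ} (hn : n < 0) {x : TensorAlgebra F A} (hx : x ∈ wtFil HA h p n) :
    x = 0 := by
  have := wtFil_induction (LinearMap.id) (⊥ : Submodule F (TensorAlgebra F A))
    (fun l k hl hk => by have := hl.nonneg; omega) x hx
  simpa using this

lemma Letter.mul_mem {a : A} {w n : ℤ} (ha : Letter HA h p a w) {y : TensorAlgebra F A}
    (hy : y ∈ wtFil HA h p n) : TensorAlgebra.ι F a * y ∈ wtFil HA h p (n + w) := by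
  refine wtFil_induction (LinearMap.mulLeft F (TensorAlgebra.ι F a)) _ (fun l k hl hk => ?_) y hy
  have := (Word.cons ha hl).bar_mem (n := n + w) (by linarith)
  rwa [bar_cons] at this

lemma hom_induction {V : Type} [AddCommGroup V] [Module F V]
    (hs : Submodule.span F {a | ∃ m, HA a m} = ⊤)
    (φ : A →ₗ[F] V) (S : Submodule F V) (H : ∀ a m, HA a m → φ a ∈ S) (a : A) : φ a ∈ S := by
  have : (⊤ : Submodule F A) ≤ S.comap φ := by
    rw [← hs]
    refine Submodule.span_le.2 ?_
    rintro x ⟨m, hx⟩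
    exact H x m hx
  exact this trivial

lemma hom_ext {V : Type} [AddCommGroup V] [Module F V]
    (hs : Submodule.span F {a | ∃ m, HA a m} = ⊤)
    {φ ψ : A →ₗ[F] V} (H : ∀ a m, HA a m → φ a = ψ a) : φ = ψ :=
  LinearMap.ext_on hs (fun a ⟨m, ha⟩ => H a m ha)

lemma ι_mul_mem_wtFil (hs : Submodule.span F {a | ∃ m, HA a m} = ⊤) (a : A) {n : ℤ}
    {y : TensorAlgebra F A} (hy : y ∈ wtFil HA h p n) :
    TensorAlgebra.ι F a * y ∈ wtFil HA h p (n + 5) :=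
  hom_induction hs (LinearMap.mulRight F y ∘ₗ TensorAlgebra.ι F) _
    (fun _ _ hb => (Letter.of hb).mul_mem hy) a

lemma ι_h_mul_mem_wtFil (hs : Submodule.span F {a | ∃ m, HA a m} = ⊤) (a : A) {n : ℤ}
    {y : TensorAlgebra F A} (hy : y ∈ wtFil HA h p n) :
    TensorAlgebra.ι F (h a) * y ∈ wtFil HA h p (n + 3) :=
  hom_induction hs (LinearMap.mulRight F y ∘ₗ TensorAlgebra.ι F ∘ₗ h) _
    (fun _ _ hb => (Letter.of_h hb).mul_mem hy) a

lemma ι_p_mul_mem_wtFil (hs : Submodule.span F {a | ∃ m, HA a m} = ⊤) (a : A) {n : ℤ}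
    {y : TensorAlgebra F A} (hy : y ∈ wtFil HA h p n) :
    TensorAlgebra.ι F (p a) * y ∈ wtFil HA h p (n + 4) :=
  hom_induction hs (LinearMap.mulRight F y ∘ₗ TensorAlgebra.ι F ∘ₗ p) _
    (fun _ _ hb => (Letter.of_p hb).mul_mem hy) a

variable (HA h p) in
lemma exists_mem_wtFil (hs : Submodule.span F {a | ∃ m, HA a m} = ⊤) (x : TensorAlgebra F A) :
    ∃ n, x ∈ wtFil HA h p n := by
  suffices H : ∀ y, (∃ n, y ∈ wtFil HA h p n) → ∃ n, x * y ∈ wtFil HA h p n by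
    have := H 1 ⟨0, by simpa [bar_nil] using (Word.nil (HA := HA) (h := h) (p := p)).bar_mem le_rfl⟩
    simpa using this
  induction x using TensorAlgebra.induction with
  | algebraMap r =>
    rintro y ⟨n, hy⟩
    exact ⟨n, by rw [← Algebra.smul_def]; exact Submodule.smul_mem _ _ hy⟩
  | ι a =>
    rintro y ⟨n, hy⟩
    exact ⟨n + 5, ι_mul_mem_wtFil hs a hy⟩
  | mul a b ha hb =>
    intro y hy
    rw [mul_assoc]
    exact ha _ (hb _ hy)
  | add a b ha hb =>
    intro y hy
    obtain ⟨m, hm⟩ := ha y hy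
    obtain ⟨n, hn⟩ := hb y hy
    refine ⟨max m n, ?_⟩
    rw [add_mul]
    exact add_mem (wtFil_mono (le_max_left _ _) hm) (wtFil_mono (le_max_right _ _) hn)

lemma bijective_one_add_of_lowers_wtFil (hs : Submodule.span F {a | ∃ m, HA a m} = ⊤)
    (X : Module.End F (TensorAlgebra F A))
    (hX : ∀ n, ∀ y ∈ wtFil HA h p n, X y ∈ wtFil HA h p (n - 1)) :
    Function.Bijective ⇑(1 + X) := by
  refine bijective_one_add_of_locally_nilpotent X fun x => ?_
  obtain ⟨n, hn⟩ := exists_mem_wtFil HA h p hs x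
  have H : ∀ k : ℕ, (X ^ k) x ∈ wtFil HA h p (n - k) := by
    intro k
    induction k with
    | zero => simpa using hn
    | succ k ih =>
      rw [pow_succ', Module.End.mul_apply]
      have := hX _ _ ih
      rwa [sub_sub] at this
  refine ⟨n.toNat + 1, wtFil_neg ?_ (H _)⟩
  push_cast
  have := Int.self_le_toNat n
  omega

end Filtration

section Perturbation

variable {F A : Type} [Field F] [AddCommGroup A] [Module F A]

/-- A family of operators of tensor-trick type: on a word, `K e` applies `p` to an initial
segment, `κ` to the next letter and nothing to the rest, where `κ` may depend on the parity
of the (shifted) degree of the initial segment. -/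
structure IsTrick (HA : A → ℤ → Prop) (h p : A →ₗ[F] A) (κ : ℤ → A →ₗ[F] A)
    (K : ℤ → Module.End F (TensorAlgebra F A)) : Prop where
  one : ∀ e, K e 1 = 0
  ι_mul : ∀ e a m, HA a m → ∀ y, K e (TensorAlgebra.ι F a * y) =
    TensorAlgebra.ι F (κ e a) * y +
      sg F (m - 1) • (TensorAlgebra.ι F (p a) * K (e + (m - 1)) y)
  comp_h : ∀ e a, κ e (h a) = 0
  comp_p : ∀ e a, κ e (p a) = 0
  range : ∀ e a, ∃ b, κ e a = h b

/-- An operator behaving like a coderivation with linear part `D`, up to terms shortening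
words. -/
structure IsCoder (HA : A → ℤ → Prop) (h p D θ : A →ₗ[F] A) (μ : ℤ)
    (M : Module.End F (TensorAlgebra F A)) : Prop where
  one : M 1 = 0
  theta : ∀ a m, HA a m → θ a = sg F ((μ - 1) * (m - 1)) • a
  defect : ∀ a n, ∀ y ∈ wtFil HA h p n,
    M (TensorAlgebra.ι F a * y) - TensorAlgebra.ι F (θ a) * M y - TensorAlgebra.ι F (D a) * y
      ∈ wtFil HA h p (n + 2)

/-- The side conditions on `h` and the projection `p`, and their degrees. -/
structure IsSide (HA : A → ℤ → Prop) (h p : A →ₗ[F] A) : Prop where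
  span : Submodule.span F {a | ∃ m, HA a m} = ⊤
  hh : ∀ a, h (h a) = 0
  ph : ∀ a, p (h a) = 0
  hp : ∀ a, h (p a) = 0
  pp : ∀ a, p (p a) = p a
  degh : ∀ a m, HA a m → HA (h a) (m - 1)
  degp : ∀ a m, HA a m → HA (p a) m

variable {HA : A → ℤ → Prop} {h p D θ : A →ₗ[F] A} {μ : ℤ}
  {M : Module.End F (TensorAlgebra F A)}
  {κ lam : ℤ → A →ₗ[F] A} {K L : ℤ → Module.End F (TensorAlgebra F A)}

lemma IsTrick.neg (hK : IsTrick HA h p κ K) : IsTrick HA h p (-κ) (-K) where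
  one e := by simp [hK.one]
  ι_mul e a m ha y := by
    simp only [Pi.neg_apply, LinearMap.neg_apply, hK.ι_mul e a m ha, map_neg, neg_mul, mul_neg,
      smul_neg, neg_add]
  comp_h e a := by simp [hK.comp_h]
  comp_p e a := by simp [hK.comp_p]
  range e a := by
    obtain ⟨b, hb⟩ := hK.range e a
    exact ⟨-b, by simp [hb]⟩

lemma Letter.exists_deg (hS : IsSide HA h p) {a : A} {w : ℤ} (ha : Letter HA h p a w) :
    ∃ m, HA a m := by
  cases ha with
  | of_h hb => exact ⟨_, hS.degh _ _ hb⟩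
  | of_p hb => exact ⟨_, hS.degp _ _ hb⟩
  | of hb => exact ⟨_, hb⟩

lemma Word.exists_admW (hS : IsSide HA h p) {l : List A} {n : ℤ} (hl : Word HA h p l n) :
    ∃ ds, AdmW A HA l ds := by
  induction hl with
  | nil => exact ⟨[], admW_nil HA⟩
  | cons ha _ ih =>
    obtain ⟨ds, hds⟩ := ih
    obtain ⟨m, hm⟩ := ha.exists_deg hS
    exact ⟨m :: ds, hds.cons hm⟩

lemma IsTrick.ι_h_mul (hS : IsSide HA h p) (hK : IsTrick HA h p κ K) (e : ℤ) (b : A)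
    (y : TensorAlgebra F A) : K e (TensorAlgebra.ι F (h b) * y) = 0 := by
  refine (Submodule.mem_bot F).1 (hom_induction hS.span
    (K e ∘ₗ LinearMap.mulRight F y ∘ₗ TensorAlgebra.ι F ∘ₗ h) ⊥ (fun a m ha => ?_) b)
  simp [hK.ι_mul _ _ _ (hS.degh _ _ ha), hK.comp_h, hS.ph]

lemma IsTrick.ι_p_mul (hS : IsSide HA h p) (hK : IsTrick HA h p κ K) (e : ℤ) {a : A} {m : ℤ}
    (ha : HA a m) (y : TensorAlgebra F A) : K e (TensorAlgebra.ι F (p a) * y) =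
      sg F (m - 1) • (TensorAlgebra.ι F (p a) * K (e + (m - 1)) y) := by
  rw [hK.ι_mul _ _ _ (hS.degp _ _ ha), hK.comp_p, hS.pp, map_zero, zero_mul, zero_add]

lemma IsTrick.mem_wtFil (hS : IsSide HA h p) (hK : IsTrick HA h p κ K) (e n : ℤ) :
    ∀ y ∈ wtFil HA h p n, K e y ∈ wtFil HA h p (n - 2) := by
  refine wtFil_induction (K e) _ fun l k hl hk => ?_
  refine wtFil_mono (sub_le_sub_right hk 2) ?_
  clear hk
  induction hl generalizing e with
  | nil => rw [bar_nil, hK.one]; exact zero_mem _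
  | @cons a w l n ha hl ih =>
    rw [bar_cons]
    cases ha with
    | of_h hb => rw [hK.ι_h_mul hS]; exact zero_mem _
    | of_p hb =>
      rw [hK.ι_p_mul hS _ hb]
      exact Submodule.smul_mem _ _
        (wtFil_mono (by linarith) (ι_p_mul_mem_wtFil hS.span _ (ih _)))
    | of hb =>
      rw [hK.ι_mul _ _ _ hb]
      obtain ⟨c, hc⟩ := hK.range e a
      rw [hc]
      exact add_mem
        (wtFil_mono (by linarith) (ι_h_mul_mem_wtFil hS.span _ (hl.bar_mem le_rfl)))
        (Submodule.smul_mem _ _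
          (wtFil_mono (by linarith) (ι_p_mul_mem_wtFil hS.span _ (ih _))))

lemma IsTrick.ι_mul_sub_mem (hS : IsSide HA h p) (hK : IsTrick HA h p κ K) (e : ℤ) (b : A)
    {n : ℤ} {y : TensorAlgebra F A} (hy : y ∈ wtFil HA h p n) :
    K e (TensorAlgebra.ι F b * y) - TensorAlgebra.ι F (κ e b) * y ∈ wtFil HA h p (n + 2) := by
  refine hom_induction hS.span
    (K e ∘ₗ LinearMap.mulRight F y ∘ₗ TensorAlgebra.ι F -
      LinearMap.mulRight F y ∘ₗ TensorAlgebra.ι F ∘ₗ κ e) _ (fun a m ha => ?_) b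
  simp only [LinearMap.sub_apply, LinearMap.comp_apply, LinearMap.mulRight_apply,
    hK.ι_mul _ _ _ ha, add_sub_cancel_left]
  exact Submodule.smul_mem _ _ (wtFil_mono (by linarith)
    (ι_p_mul_mem_wtFil hS.span _ (hK.mem_wtFil hS _ _ _ hy)))

lemma IsCoder.theta_h (hS : IsSide HA h p) (hM : IsCoder HA h p D θ μ M) (b : A) :
    ∃ c, θ (h b) = h c := by
  have := hom_induction hS.span (θ ∘ₗ h) (LinearMap.range h) (fun a m ha => ?_) b
  · obtain ⟨c, hc⟩ := this
    exact ⟨c, hc.symm⟩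
  · rw [LinearMap.comp_apply, hM.theta _ _ (hS.degh _ _ ha)]
    exact Submodule.smul_mem _ _ ⟨a, rfl⟩

lemma IsCoder.mem_wtFil (hS : IsSide HA h p) (hM : IsCoder HA h p D θ μ M) (n : ℤ) :
    ∀ y ∈ wtFil HA h p n, M y ∈ wtFil HA h p (n + 2) := by
  refine wtFil_induction M _ fun l k hl hk => ?_
  refine wtFil_mono (add_le_add_left hk 2) ?_
  clear hk
  induction hl with
  | nil => rw [bar_nil, hM.one]; exact zero_mem _
  | @cons a w l n ha hl ih =>
    rw [bar_cons]
    have hw := ha.three_le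
    obtain ⟨m, hm⟩ := ha.exists_deg hS
    have h1 := wtFil_mono (n := n + w + 2) (by linarith)
      (hM.defect a n _ (hl.bar_mem le_rfl))
    have h2 := wtFil_mono (n := n + w + 2) (by linarith)
      (ι_mul_mem_wtFil hS.span (D a) (hl.bar_mem le_rfl))
    have h3 := wtFil_mono (n := n + w + 2) (by linarith)
      (Submodule.smul_mem _ (sg F ((μ - 1) * (m - 1))) (ha.mul_mem ih))
    rw [hM.theta _ _ hm, map_smul, smul_mul_assoc] at h1
    have := add_mem (add_mem h1 h2) h3
    rwa [sub_add_cancel, sub_add_cancel] at this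

/-- If `lam - κ = ± lam D κ` at the level of letters, the corresponding identity of
tensor-trick operators holds up to terms of lower weight. -/
lemma IsTrick.sub_sub_mem (hS : IsSide HA h p) (hM : IsCoder HA h p D θ μ M)
    (hL : IsTrick HA h p lam L) (hK : IsTrick HA h p κ K)
    (hrel : ∀ e a, lam e a - κ e a - sg F (μ * e) • lam e (D (κ e a)) = 0) (e n : ℤ) :
    ∀ y ∈ wtFil HA h p n,
      L e y - K e y - sg F (μ * e) • L e (M (K e y)) ∈ wtFil HA h p (n - 3) := by
  have key := wtFil_induction (HA := HA) (h := h) (p := p) (n := n)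
    (L e - K e - sg F (μ * e) • (L e ∘ₗ M ∘ₗ K e)) (wtFil HA h p (n - 3)) (fun l k hl hk => ?_)
  · simpa using key
  refine wtFil_mono (sub_le_sub_right hk 3) ?_
  clear hk
  simp only [LinearMap.sub_apply, LinearMap.smul_apply, LinearMap.comp_apply]
  induction hl generalizing e with
  | nil => simp [bar_nil, hK.one, hL.one]
  | @cons a w l n ha hl ih =>
    rw [bar_cons]
    set x := bar F A l with hx
    have hxm : x ∈ wtFil HA h p n := hl.bar_mem le_rfl
    obtain ⟨m, hm⟩ := ha.exists_deg hS
    set K' := K (e + (m - 1))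
    set L' := L (e + (m - 1))
    set E₁ := L e (TensorAlgebra.ι F (D (κ e a)) * x)
      - TensorAlgebra.ι F (lam e (D (κ e a))) * x with hE₁
    set N₁ := M (TensorAlgebra.ι F (κ e a) * x) - TensorAlgebra.ι F (θ (κ e a)) * M x
      - TensorAlgebra.ι F (D (κ e a)) * x with hN₁
    set N₂ := M (TensorAlgebra.ι F (p a) * K' x) - TensorAlgebra.ι F (θ (p a)) * M (K' x)
      - TensorAlgebra.ι F (D (p a)) * K' x with hN₂
    set S' := L' x - K' x - sg F (μ * (e + (m - 1))) • L' (M (K' x)) with hS'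
    have hzero : L e (TensorAlgebra.ι F (θ (κ e a)) * M x) = 0 := by
      obtain ⟨b, hb⟩ := hK.range e a
      obtain ⟨c, hc⟩ := hM.theta_h hS b
      rw [hb, hc, hL.ι_h_mul hS]
    have hLM : L e (TensorAlgebra.ι F (θ (p a)) * M (K' x)) =
        (sg F ((μ - 1) * (m - 1)) * sg F (m - 1)) • (TensorAlgebra.ι F (p a) * L' (M (K' x))) := by
      rw [hM.theta _ _ (hS.degp _ _ hm), map_smul, smul_mul_assoc, map_smul,
        hL.ι_p_mul hS _ hm, smul_smul]
    have hMK₁ : L e (M (TensorAlgebra.ι F (κ e a) * x)) =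
        L e N₁ + E₁ + TensorAlgebra.ι F (lam e (D (κ e a))) * x := by
      rw [hN₁, hE₁, map_sub, map_sub, hzero]; abel
    have hMK₂ : L e (M (TensorAlgebra.ι F (p a) * K' x)) =
        L e N₂ + L e (TensorAlgebra.ι F (D (p a)) * K' x) +
        (sg F ((μ - 1) * (m - 1)) * sg F (m - 1)) •
          (TensorAlgebra.ι F (p a) * L' (M (K' x))) := by
      rw [← hLM, hN₂, map_sub, map_sub]; abel
    have hsign : sg F (μ * e) * (sg F (m - 1) * (sg F ((μ - 1) * (m - 1)) * sg F (m - 1)))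
        = sg F (m - 1) * sg F (μ * (e + (m - 1))) := by
      rw [← sg_add, ← sg_add, ← sg_add, ← sg_add]
      congr 1
      ring
    have hmain : L e (TensorAlgebra.ι F a * x) - K e (TensorAlgebra.ι F a * x)
        - sg F (μ * e) • L e (M (K e (TensorAlgebra.ι F a * x))) =
        sg F (m - 1) • (TensorAlgebra.ι F (p a) * S') - sg F (μ * e) • E₁
          - sg F (μ * e) • L e N₁ - (sg F (μ * e) * sg F (m - 1)) • L e N₂
          - (sg F (μ * e) * sg F (m - 1)) • L e (TensorAlgebra.ι F (D (p a)) * K' x) := by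
      have h0 : TensorAlgebra.ι F (lam e a) * x = TensorAlgebra.ι F (κ e a) * x
          + sg F (μ * e) • (TensorAlgebra.ι F (lam e (D (κ e a))) * x) := by
        rw [← smul_mul_assoc, ← map_smul, ← add_mul, ← map_add]
        congr 2
        rw [← sub_eq_zero, ← hrel e a]
        abel
      rw [hL.ι_mul _ _ _ hm, hK.ι_mul _ _ _ hm, map_add, map_smul, map_add, map_smul, hMK₁, hMK₂,
        h0, hS']
      simp only [smul_add, smul_smul, mul_sub, smul_sub, mul_smul_comm, ← hsign]
      abel
    rw [hmain]
    have hw := ha.three_le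
    have hN₁m : L e N₁ ∈ wtFil HA h p (n + w - 3) :=
      wtFil_mono (by linarith) (hL.mem_wtFil hS e _ _ (hM.defect (κ e a) n x hxm))
    have hK'm := hK.mem_wtFil hS (e + (m - 1)) n x hxm
    have hN₂m : L e N₂ ∈ wtFil HA h p (n + w - 3) :=
      wtFil_mono (by linarith) (hL.mem_wtFil hS e _ _ (hM.defect (p a) (n - 2) _ hK'm))
    have hE₁m : E₁ ∈ wtFil HA h p (n + w - 3) := by
      cases ha with
      | of_h hb => simp [hE₁, hK.comp_h]
      | of_p hb => simp [hE₁, hK.comp_p]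
      | of hb => exact wtFil_mono (by linarith) (hL.ι_mul_sub_mem hS e _ hxm)
    have hSm : TensorAlgebra.ι F (p a) * S' ∈ wtFil HA h p (n + w - 3) ∧
        L e (TensorAlgebra.ι F (D (p a)) * K' x) ∈ wtFil HA h p (n + w - 3) := by
      have h1 := ι_p_mul_mem_wtFil hS.span a (ih (e + (m - 1)))
      have h2 : L e (TensorAlgebra.ι F (D (p a)) * K' x) ∈ wtFil HA h p (n + 1) := by
        obtain ⟨c, hc⟩ := hL.range e (D (p a))
        have h3 := wtFil_mono (n := n + 1) (by linarith) (hL.ι_mul_sub_mem hS e (D (p a)) hK'm)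
        have h4 := wtFil_mono (n := n + 1) (by linarith) (ι_h_mul_mem_wtFil hS.span c hK'm)
        rw [← hc] at h4
        have := add_mem h3 h4
        rwa [sub_add_cancel] at this
      cases ha with
      | of_h hb => simp [hS.ph]
      | of_p hb => exact ⟨wtFil_mono (by linarith) h1, wtFil_mono (by linarith) h2⟩
      | of hb => exact ⟨wtFil_mono (by linarith) h1, wtFil_mono (by linarith) h2⟩
    exact sub_mem (sub_mem (sub_mem (sub_mem (Submodule.smul_mem _ _ hSm.1)
      (Submodule.smul_mem _ _ hE₁m)) (Submodule.smul_mem _ _ hN₁m))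
      (Submodule.smul_mem _ _ hN₂m)) (Submodule.smul_mem _ _ hSm.2)

lemma one_sub_mul_mul_one_add_mul {R : Type} [Ring R] (a b c : R) :
    (1 - a * b) * (1 + a * c) = 1 + a * (-b - -c - -b * a * -c) := by
  noncomm_ring

lemma IsTrick.bijective_one_add (hS : IsSide HA h p) (hM : IsCoder HA h p D θ μ M)
    (hL : IsTrick HA h p lam L) (hK : IsTrick HA h p κ K)
    (hLK : ∀ e a, lam e a - κ e a - sg F (μ * e) • lam e (D (κ e a)) = 0)
    (hKL : ∀ e a, lam e a - κ e a - sg F (μ * e) • κ e (D (lam e a)) = 0) :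
    Function.Bijective ⇑(1 + M * L 0) := by
  have h1 : Function.Bijective ⇑((1 + M * L 0) * (1 - M * K 0)) := by
    have : (1 + M * L 0) * (1 - M * K 0) = 1 + M * (L 0 - K 0 - L 0 * M * K 0) := by
      simp only [add_mul, mul_sub, one_mul, mul_one, mul_assoc]
      abel
    rw [this]
    refine bijective_one_add_of_lowers_wtFil (HA := HA) (h := h) (p := p) hS.span _
      fun n y hy => ?_
    have := hM.mem_wtFil hS _ _ (hL.sub_sub_mem hS hM hK hLK 0 n y hy)
    refine wtFil_mono (m := n - 3 + 2) (by linarith) ?_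
    simpa [sg] using this
  have h2 : Function.Bijective ⇑((1 - M * K 0) * (1 + M * L 0)) := by
    have : (1 - M * K 0) * (1 + M * L 0) =
        1 + M * (-K 0 - -L 0 - -K 0 * M * -L 0) :=
      one_sub_mul_mul_one_add_mul M (K 0) (L 0)
    rw [this]
    refine bijective_one_add_of_lowers_wtFil (HA := HA) (h := h) (p := p) hS.span _
      fun n y hy => ?_
    have hrel : ∀ e a, (-κ) e a - (-lam) e a - sg F (μ * e) • (-κ) e (D ((-lam) e a)) = 0 := by
      intro e a
      rw [← hKL e a]
      simp only [Pi.neg_apply, LinearMap.neg_apply, map_neg, neg_neg]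
      abel
    have := hM.mem_wtFil hS _ _ (hK.neg.sub_sub_mem hS hM hL.neg hrel 0 n y hy)
    refine wtFil_mono (m := n - 3 + 2) (by linarith) ?_
    simpa [sg] using this
  rw [Module.End.mul_eq_comp, LinearMap.coe_comp] at h1 h2
  exact ⟨h2.injective.of_comp, h1.surjective.of_comp⟩

end Perturbation

section BarData

variable {F A Z : Type} [Field F]
  [AddCommGroup A] [Module F A] [AddCommGroup Z] [Module F Z]
  {HA : A → ℤ → Prop} {HZ : Z → ℤ → Prop} {dA : A →ₗ[F] A} {dZ : Z →ₗ[F] Z}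

lemma Contraction.isSide (hA : IsCx HA dA) (C : Contraction F A Z HA HZ dA dZ) :
    IsSide HA C.h (C.g ∘ₗ C.f) where
  span := hA.span_hom
  hh a := LinearMap.congr_fun C.hh a
  ph a := by
    have := LinearMap.congr_fun C.fh a
    simp only [LinearMap.comp_apply, LinearMap.zero_apply] at this
    simp [this]
  hp a := LinearMap.congr_fun C.hg (C.f a)
  pp a := by
    have := LinearMap.congr_fun C.fg (C.f a)
    simp only [LinearMap.comp_apply, LinearMap.id_apply] at this
    simp [this]
  degh := C.hdeg
  degp a m ha := C.gdeg _ _ (C.fdeg _ _ ha)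

variable {C : Contraction F A Z HA HZ dA dZ} (B : BarData F A Z HA HZ dA dZ C)

lemma BarData.mucod_one : B.mucod 1 = 0 := by
  have := B.mucod_bar [] [] (admW_nil HA)
  simpa [bar_nil] using this

lemma BarData.hB_one : B.hB 1 = 0 := by
  have := B.hB_bar [] [] (admW_nil HA)
  simpa [bar_nil] using this

lemma BarData.hB_ι_mul_bar {a : A} {m : ℤ} (ha : HA a m) {l : List A} {ds : List ℤ}
    (hl : AdmW A HA l ds) : B.hB (TensorAlgebra.ι F a * bar F A l) =
      TensorAlgebra.ι F (C.h a) * bar F A l +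
        sg F (m - 1) • (TensorAlgebra.ι F ((C.g ∘ₗ C.f) a) * B.hB (bar F A l)) := by
  rw [← bar_cons, B.hB_bar _ _ (hl.cons ha), B.hB_bar _ _ hl, List.length_cons,
    Finset.sum_range_succ', add_comm]
  congr 1
  · simp [bar_cons, sg, om]
  · rw [Finset.mul_sum, Finset.smul_sum]
    refine Finset.sum_congr rfl fun j _ => ?_
    simp only [List.take_succ_cons, om_cons, sg_add, List.map_cons, List.getD_cons_succ,
      List.drop_succ_cons, List.cons_append, bar_cons, mul_smul, mul_smul_comm]

lemma BarData.mucod_ι_mul_bar {a : A} {m : ℤ} (ha : HA a m) {l : List A} {ds : List ℤ}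
    (hl : AdmW A HA l ds) : B.mucod (TensorAlgebra.ι F a * bar F A l) =
      sg F ((B.degmu - 1) * (m - 1)) • (TensorAlgebra.ι F a * B.mucod (bar F A l)) +
        ∑ j ∈ Finset.range (l.length + 1),
          TensorAlgebra.ι F (B.mu (bar F A (a :: l.take j))) * bar F A (l.drop j) := by
  have shift : ∀ (n : ℕ) (G : ℕ → TensorAlgebra F A),
      ∑ j ∈ Finset.Icc 1 n, G j = ∑ j ∈ Finset.range n, G (j + 1) := by
    intro n G
    rw [Finset.range_eq_Ico, Finset.sum_Ico_add' G 0 n 1]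
    rfl
  rw [← bar_cons, B.mucod_bar _ _ (hl.cons ha), B.mucod_bar _ _ hl, List.length_cons,
    shift, shift]
  rw [Finset.sum_congr rfl fun j _ => Finset.sum_range_succ' _ j, Finset.sum_add_distrib,
    Finset.sum_range_succ']
  congr 1
  · rw [Finset.sum_range_zero, add_zero, Finset.mul_sum, Finset.smul_sum]
    refine Finset.sum_congr rfl fun j _ => ?_
    rw [Finset.mul_sum, Finset.smul_sum]
    refine Finset.sum_congr rfl fun i _ => ?_
    simp only [List.take_succ_cons, om_cons, mul_add, sg_add,
      List.drop_succ_cons, List.cons_append, bar_cons, mul_smul, mul_smul_comm]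
  · refine Finset.sum_congr rfl fun j _ => ?_
    simp [bar_cons, sg, om]

lemma BarData.isTrick_hB (hA : IsCx HA dA) :
    IsTrick HA C.h (C.g ∘ₗ C.f) (fun _ => C.h) (fun _ => B.hB) where
  one _ := B.hB_one
  ι_mul _ a m ha y := by
    obtain ⟨n, hn⟩ := exists_mem_wtFil HA C.h (C.g ∘ₗ C.f) hA.span_hom y
    have := wtFil_induction (B.hB ∘ₗ LinearMap.mulLeft F (TensorAlgebra.ι F a)
      - LinearMap.mulLeft F (TensorAlgebra.ι F (C.h a))
      - sg F (m - 1) • LinearMap.mulLeft F (TensorAlgebra.ι F ((C.g ∘ₗ C.f) a)) ∘ₗ B.hB) ⊥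
      (fun l k hl _ => ?_) y hn
    · rw [Submodule.mem_bot] at this
      rw [← sub_eq_zero, ← this]
      simp only [LinearMap.sub_apply, LinearMap.comp_apply, LinearMap.smul_apply,
        LinearMap.mulLeft_apply]
      abel
    · obtain ⟨ds, hds⟩ := hl.exists_admW (C.isSide hA)
      simp [B.hB_ι_mul_bar ha hds]
  comp_h _ a := LinearMap.congr_fun C.hh a
  comp_p _ a := (C.isSide hA).hp a
  range _ a := ⟨a, rfl⟩

lemma BarData.isCoder_mucod (hA : IsCx HA dA) {θ : A →ₗ[F] A}
    (hθ : ∀ a m, HA a m → θ a = sg F ((B.degmu - 1) * (m - 1)) • a) :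
    IsCoder HA C.h (C.g ∘ₗ C.f) (B.mu ∘ₗ TensorAlgebra.ι F) θ B.degmu B.mucod where
  one := B.mucod_one
  theta := hθ
  defect a n y hy := by
    have hS := C.isSide hA
    have h1 := hom_induction hS.span
      (B.mucod ∘ₗ LinearMap.mulRight F y ∘ₗ TensorAlgebra.ι F
        - LinearMap.mulRight F (B.mucod y) ∘ₗ TensorAlgebra.ι F ∘ₗ θ
        - LinearMap.mulRight F y ∘ₗ TensorAlgebra.ι F ∘ₗ B.mu ∘ₗ TensorAlgebra.ι F)
      (wtFil HA C.h (C.g ∘ₗ C.f) (n + 2)) (fun b m hb => ?_) a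
    · simpa using h1
    have h2 := wtFil_induction
      (B.mucod ∘ₗ LinearMap.mulLeft F (TensorAlgebra.ι F b)
        - LinearMap.mulLeft F (TensorAlgebra.ι F (θ b)) ∘ₗ B.mucod
        - LinearMap.mulLeft F (TensorAlgebra.ι F (B.mu (TensorAlgebra.ι F b))))
      (wtFil HA C.h (C.g ∘ₗ C.f) (n + 2)) (fun l k hl hk => ?_) y hy
    · simpa using h2
    obtain ⟨ds, hds⟩ := hl.exists_admW hS
    simp only [LinearMap.sub_apply, LinearMap.comp_apply, LinearMap.mulLeft_apply]
    rw [B.mucod_ι_mul_bar hb hds, hθ _ _ hb, map_smul, smul_mul_assoc, add_sub_cancel_left,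
      Finset.sum_range_succ']
    simp only [List.take_zero, bar_cons, bar_nil, mul_one, List.drop_zero, add_sub_cancel_right]
    refine sum_mem fun j hj => ?_
    obtain ⟨k', hk', hw⟩ := hl.drop_succ (Finset.mem_range.1 hj)
    exact wtFil_mono (by linarith) (ι_mul_mem_wtFil hS.span _ (hw.bar_mem hk'))

/-- The shifted parity operator is linear as soon as the differential is nonzero. -/
lemma BarData.exists_parity (B : BarData F A Z HA HZ dA dZ C) (hA : IsCx HA dA) (hd : dA ≠ 0) :
    ∃ τ : A →ₗ[F] A, ∀ a m, HA a m → τ a = sg F (m - 1) • a := by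
  obtain ⟨b, n, hb, hdb⟩ : ∃ b n, HA b n ∧ dA b ≠ 0 := by
    by_contra! H
    exact hd (hom_ext hA.span_hom (by simpa using H))
  obtain ⟨ψ, hψ⟩ := Module.Projective.exists_dual_eq_one F hdb
  have two : ∀ a m, HA a m → B.dB1 (TensorAlgebra.ι F a * TensorAlgebra.ι F b) =
      TensorAlgebra.ι F (dA a) * TensorAlgebra.ι F b +
        sg F (m - 1) • (TensorAlgebra.ι F a * TensorAlgebra.ι F (dA b)) := by
    intro a m ha
    have := B.dB1_bar [a, b] [m, n] (((admW_nil HA).cons hb).cons ha)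
    simpa [Finset.sum_range_succ, bar_cons, bar_nil, om, sg] using this
  refine ⟨contractSecond ψ ∘ₗ (B.dB1 ∘ₗ LinearMap.mulRight F (TensorAlgebra.ι F b) ∘ₗ
    TensorAlgebra.ι F - LinearMap.mulRight F (TensorAlgebra.ι F b) ∘ₗ
    TensorAlgebra.ι F ∘ₗ dA), fun a m ha => ?_⟩
  simp [two a m ha, contractSecond_ι_mul_ι, hψ]

/-- The homotopy `h (1 + D h)⁻¹` and its parity conjugate give rise to a tensor-trick family. -/
lemma exists_isTrick_of_parity [CharZero F] {h p D τ κ₀ : A →ₗ[F] A} {μ : ℤ}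
    (hS : IsSide HA h p) (hτ : ∀ a m, HA a m → τ a = sg F (m - 1) • a)
    (hD : ∀ a m, HA a m → HA (D a) (m - 1 + μ))
    (hκr : ∀ a, ∃ b, κ₀ a = h b) (hκh : ∀ a, κ₀ (h a) = 0) (hκp : ∀ a, κ₀ (p a) = 0)
    (hL : ∀ a, h a - κ₀ a - h (D (κ₀ a)) = 0) (hR : ∀ a, h a - κ₀ a - κ₀ (D (h a)) = 0) :
    ∃ (κ : ℤ → A →ₗ[F] A) (K : ℤ → Module.End F (TensorAlgebra F A)),
      IsTrick HA h p κ K ∧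
      (∀ e a, h a - κ e a - sg F (μ * e) • h (D (κ e a)) = 0) ∧
      (∀ e a, h a - κ e a - sg F (μ * e) • κ e (D (h a)) = 0) := by
  have hττ : ∀ a, τ (τ a) = a := fun a => LinearMap.congr_fun (f := τ ∘ₗ τ) (g := LinearMap.id)
    (hom_ext hS.span fun a m ha => by simp [hτ a m ha, smul_smul, sg_mul_self]) a
  have hτp : ∀ a, τ (p a) = p (τ a) := fun a => LinearMap.congr_fun (f := τ ∘ₗ p) (g := p ∘ₗ τ)
    (hom_ext hS.span fun a m ha => by simp [hτ a m ha, hτ _ _ (hS.degp a m ha)]) a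
  have hτh : ∀ a, τ (h a) = - h (τ a) := fun a =>
    LinearMap.congr_fun (f := τ ∘ₗ h) (g := - (h ∘ₗ τ))
    (hom_ext hS.span fun a m ha => by
      have : sg F (m - 1 - 1) = - sg F (m - 1) := by
        rw [sub_eq_add_neg _ (1 : ℤ), sg_add, sg_odd F (x := -1) (by decide), mul_neg_one]
      simp [hτ a m ha, hτ _ _ (hS.degh a m ha), this]) a
  have hτD : ∀ a, τ (D a) = - sg F μ • D (τ a) := fun a =>
    LinearMap.congr_fun (f := τ ∘ₗ D) (g := - sg F μ • (D ∘ₗ τ))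
    (hom_ext hS.span fun a m ha => by
      have : sg F (m - 1 + μ - 1) = - sg F μ * sg F (m - 1) := by
        rw [sub_eq_add_neg _ (1 : ℤ), sg_add, sg_odd F (x := -1) (by decide), sg_add]
        ring
      simp only [LinearMap.comp_apply, LinearMap.smul_apply, hτ a m ha, hτ _ _ (hD a m ha), this,
        map_smul, smul_smul]) a
  set κ₁ : A →ₗ[F] A := -(τ ∘ₗ κ₀ ∘ₗ τ) with hκ₁
  have hκ₁a : ∀ a, κ₁ a = - τ (κ₀ (τ a)) := fun a => rfl
  have h2 : (2 : F) ≠ 0 := two_ne_zero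
  set κe : A →ₗ[F] A := (2⁻¹ : F) • (κ₀ + κ₁) with hκe
  set κo : A →ₗ[F] A := (2⁻¹ : F) • (κ₀ - κ₁) with hκo
  have even : κe + κo = κ₀ := by
    rw [hκe, hκo, ← smul_add, add_add_sub_cancel, ← two_smul F κ₀, inv_smul_smul₀ h2]
  have odd : κe - κo = κ₁ := by
    rw [hκe, hκo, ← smul_sub, add_sub_sub_cancel, ← two_smul F κ₁, inv_smul_smul₀ h2]
  set κ : ℤ → A →ₗ[F] A := fun e => κe + sg F e • κo with hκ
  have parity_cases : ∀ e, (Even e ∧ κ e = κ₀) ∨ (Odd e ∧ κ e = κ₁) := by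
    intro e
    rcases Int.even_or_odd e with he | he
    · exact Or.inl ⟨he, by simp [hκ, sg_even F he, even]⟩
    · exact Or.inr ⟨he, by simp [hκ, sg_odd F he, ← odd, sub_eq_add_neg]⟩
  have hsμ : ∀ {e}, Odd e → sg F (μ * e) = sg F μ := by
    rintro e ⟨k, rfl⟩
    rw [mul_add, mul_one, sg_add, sg_even F (Even.mul_left (even_two_mul k) μ), one_mul]
  refine ⟨κ, fun e => twistedDer (τ ∘ₗ p) κe + sg F e • twistedDer p κo, ⟨?_, ?_, ?_, ?_, ?_⟩,
    ?_, ?_⟩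
  · intro e
    simp [twistedDer_one]
  · intro e a m ha y
    simp only [hκ, LinearMap.add_apply, LinearMap.smul_apply, twistedDer_ι_mul,
      LinearMap.comp_apply, hτ _ _ (hS.degp a m ha), map_add, map_smul, sg_add F e, smul_add,
      mul_add, add_mul, smul_mul_assoc, mul_smul_comm, smul_smul,
      mul_left_comm (sg F (m - 1)) (sg F e), sg_mul_self, mul_one]
    abel
  · intro e a
    rcases parity_cases e with ⟨-, hc⟩ | ⟨-, hc⟩
    · rw [hc, hκh]
    · rw [hc, hκ₁a, hτh, map_neg, hκh, neg_zero, map_zero, neg_zero]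
  · intro e a
    rcases parity_cases e with ⟨-, hc⟩ | ⟨-, hc⟩
    · rw [hc, hκp]
    · rw [hc, hκ₁a, hτp, hκp, map_zero, neg_zero]
  · intro e a
    rcases parity_cases e with ⟨-, hc⟩ | ⟨-, hc⟩
    · rw [hc]; exact hκr a
    · obtain ⟨b, hb⟩ := hκr (τ a)
      exact ⟨τ b, by rw [hc, hκ₁a, hb, hτh, neg_neg]⟩
  · intro e a
    rcases parity_cases e with ⟨he, hc⟩ | ⟨he, hc⟩
    · rw [hc, sg_even F (he.mul_left μ), one_smul, hL]
    · have := congrArg τ (hL (τ a))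
      rw [map_sub, map_sub, hτh, hτh, hττ, hτD, map_smul, map_zero] at this
      rw [hc, hsμ he, hκ₁a, ← neg_eq_zero, ← this, map_neg, map_neg]
      module
  · intro e a
    rcases parity_cases e with ⟨he, hc⟩ | ⟨he, hc⟩
    · rw [hc, sg_even F (he.mul_left μ), one_smul, hR]
    · have hDτ : D (h (τ a)) = sg F μ • τ (D (h a)) := by
        rw [hτD, hτh, map_neg, smul_neg, neg_smul, neg_neg, smul_smul, sg_mul_self, one_smul]
      have := congrArg τ (hR (τ a))
      rw [map_sub, map_sub, hDτ, hτh, hττ, map_smul, map_smul, map_zero] at this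
      rw [hc, hsμ he, hκ₁a, hκ₁a, ← neg_eq_zero, ← this]
      module

end BarData

end TTrick

/-- Let `(A, Z, f, g, h)` be a contraction of complexes and let
`μ ∈ G(A)` be a Hochschild cochain, with `δ(μ)` the associated coderivation of the bar
construction `BA` and `𝕙` the tensor-trick homotopy on `BA`.  If
`1 + δ(μ_{(1)})h : A → A` is invertible, then `1 + δ(μ)𝕙 : BA → BA` is invertible. -/
theorem tensor_trick_invertibility
    {F A Z : Type} [Field F] [CharZero F]
    [AddCommGroup A] [Module F A] [AddCommGroup Z] [Module F Z]
    (HA : A → ℤ → Prop) (HZ : Z → ℤ → Prop)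
    (dA : A →ₗ[F] A) (dZ : Z →ₗ[F] Z)
    (hA : IsCx HA dA) (hZ : IsCx HZ dZ)
    (C : Contraction F A Z HA HZ dA dZ)
    (B : BarData F A Z HA HZ dA dZ C)
    (hyp : Function.Bijective
      ⇑(LinearMap.id + B.mu ∘ₗ TensorAlgebra.ι F ∘ₗ C.h : A →ₗ[F] A)) :
    Function.Bijective
      ⇑(LinearMap.id + B.mucod ∘ₗ B.hB :
          TensorAlgebra F A →ₗ[F] TensorAlgebra F A) := by
  have hS := C.isSide hA
  set D : A →ₗ[F] A := B.mu ∘ₗ TensorAlgebra.ι F with hD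
  have hL := B.isTrick_hB hA
  by_cases hd : dA = 0
  · have hh : C.h = 0 := by
      have h1 : C.g ∘ₗ C.f = LinearMap.id := by
        rw [C.gf]
        ext a
        simp [hd]
      rw [← LinearMap.comp_id C.h, ← h1, ← LinearMap.comp_assoc, C.hg, LinearMap.zero_comp]
    have hB0 : B.hB = 0 := by
      ext x
      obtain ⟨n, hn⟩ := exists_mem_wtFil HA C.h (C.g ∘ₗ C.f) hA.span_hom x
      refine (Submodule.mem_bot F).1 (wtFil_induction B.hB ⊥ (fun l k hl _ => ?_) x hn)
      induction hl with
      | nil => simp [bar_nil, B.hB_one]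
      | cons ha hl ih =>
        obtain ⟨m, hm⟩ := ha.exists_deg hS
        rw [bar_cons, hL.ι_mul 0 _ m hm,
          (Submodule.mem_bot F).1 (ih (by linarith [ha.three_le]))]
        simp [hh]
    rw [hB0, LinearMap.comp_zero, add_zero]
    exact Function.bijective_id
  · obtain ⟨τ, hτ⟩ := B.exists_parity hA hd
    have hθ : ∀ a m, HA a m →
        (τ ^ (B.degmu - 1).natAbs) a = sg F ((B.degmu - 1) * (m - 1)) • a := by
      intro a m ha
      rw [← sg_pow_natAbs]
      generalize (B.degmu - 1).natAbs = k
      induction k with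
      | zero => simp
      | succ k ih => rw [pow_succ, Module.End.mul_apply, hτ a m ha, map_smul, ih, smul_smul,
          pow_succ']
    have hM := B.isCoder_mucod hA hθ
    have hDdeg : ∀ a m, HA a m → HA (D a) (m - 1 + B.degmu) := by
      intro a m ha
      have := B.mu_deg [a] [m] ((admW_nil HA).cons ha)
      simpa [bar_cons, bar_nil, om, hD] using this
    let e := LinearEquiv.ofBijective _ hyp
    have he : ∀ a, e a = a + D (C.h a) := fun a => rfl
    have hs : ∀ a, e.symm a + D (C.h (e.symm a)) = a := fun a => by
      rw [← he, e.apply_symm_apply]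
    have hs' : ∀ a, e.symm a + e.symm (D (C.h a)) = a := fun a => by
      rw [← map_add, ← he, e.symm_apply_apply]
    have hfix : ∀ a, C.h a = 0 → e.symm a = a := fun a ha => by
      rw [LinearEquiv.symm_apply_eq, he, ha, map_zero, add_zero]
    obtain ⟨κ, K, hK, h1, h2⟩ := exists_isTrick_of_parity (D := D) (μ := B.degmu)
      (κ₀ := C.h ∘ₗ e.symm.toLinearMap) hS hτ hDdeg (fun a => ⟨e.symm a, rfl⟩)
      (fun a => by simp [hfix _ (hS.hh a), hS.hh])
      (fun a => by
        rw [LinearMap.comp_apply, LinearEquiv.coe_coe, hfix _ (hS.hp a), hS.hp])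
      (fun a => by
        simp only [LinearMap.comp_apply, LinearEquiv.coe_coe]
        nth_rewrite 1 [← hs a]
        rw [map_add]
        abel)
      (fun a => by
        simp only [LinearMap.comp_apply, LinearEquiv.coe_coe]
        nth_rewrite 1 [← hs' a]
        rw [map_add]
        abel)
    exact hL.bijective_one_add hS hM hK h1 h2
end
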